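/- arXiv:2112.10694 — 10 statements merged into one kernel-verified Lean document; each statement's English description precedes it below -/
import Mathlib

section
/- For all real numbers x, Y, Z with x > 1, Y > 1, Z > 1, one has f(x,Y,Z) ≥ h(Y) + h(Z). -/
/-- `arccosh x = log (x + √(x² − 1))`. -/
noncomputable def arccosh (x : ℝ) : ℝ := Real.log (x + Real.sqrt (x ^ 2 - 1))

/-- `f x Y Z = arccosh ((x + Y·Z)/√((Y²−1)(Z²−1)))`. -/
noncomputable def f (x Y Z : ℝ) : ℝ :=
  arccosh ((x + Y * Z) / Real.sqrt ((Y ^ 2 - 1) * (Z ^ 2 - 1)))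

/-- `h X = (1/2)·log((X+1)/(X−1))`. -/
noncomputable def h (X : ℝ) : ℝ := (1 / 2) * Real.log ((X + 1) / (X - 1))

lemma h_eq_log_div_sqrt {X : ℝ} (hX : 1 < X) : h X = Real.log ((X + 1) / √(X ^ 2 - 1)) := by
  have hsq : 0 < X ^ 2 - 1 := by nlinarith
  have hp : X + 1 ≠ 0 := by linarith
  have hm : X - 1 ≠ 0 := by linarith
  rw [h, Real.log_div hp hm, Real.log_div hp (Real.sqrt_pos.2 hsq).ne', Real.log_sqrt hsq.le,
    show X ^ 2 - 1 = (X + 1) * (X - 1) by ring, Real.log_mul hp hm]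
  ring

lemma h_add_h {Y Z : ℝ} (hY : 1 < Y) (hZ : 1 < Z) :
    h Y + h Z = Real.log ((Y + 1) * (Z + 1) / √((Y ^ 2 - 1) * (Z ^ 2 - 1))) := by
  have hY2 : 0 < Y ^ 2 - 1 := by nlinarith
  have hZ2 : 0 < Z ^ 2 - 1 := by nlinarith
  rw [h_eq_log_div_sqrt hY, h_eq_log_div_sqrt hZ, ← Real.log_mul (by positivity) (by positivity),
    Real.sqrt_mul hY2.le, div_mul_div_comm]

theorem stmt_0 (x Y Z : ℝ) (hx : 1 < x) (hY : 1 < Y) (hZ : 1 < Z) :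
    h Y + h Z ≤ f x Y Z := by
  have hS : 0 < (Y ^ 2 - 1) * (Z ^ 2 - 1) := mul_pos (by nlinarith) (by nlinarith)
  rw [h_add_h hY hZ, f, arccosh]
  have hYZ : 0 < Y * Z := by positivity
  have hsqrt := Real.sqrt_pos.2 hS
  have hsq := Real.sq_sqrt hS.le
  set S := √((Y ^ 2 - 1) * (Z ^ 2 - 1))
  have hroot : (Y + Z) / S ≤ √(((x + Y * Z) / S) ^ 2 - 1) := by
    apply Real.le_sqrt_of_sq_le
    rw [div_pow, div_pow, le_sub_iff_add_le, div_add_one (by positivity)]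
    gcongr
    rw [hsq]
    nlinarith
  apply Real.log_le_log (by positivity)
  calc (Y + 1) * (Z + 1) / S = (1 + Y * Z) / S + (Y + Z) / S := by ring
    _ ≤ _ := by gcongr
end

section
/- For all real numbers x, Y, Z with x > 1, Y > 1, Z > 1, one has f(x,Y,Z) ≤ h(Y) + x·h(Z). -/
theorem h_pos {X : ℝ} (hX : 1 < X) : 0 < h X := by
  have : 1 < (X + 1) / (X - 1) := by
    rw [one_lt_div (by linarith)]
    linarith
  exact mul_pos (by norm_num) (Real.log_pos this)

theorem exp_h {X : ℝ} (hX : 1 < X) : Real.exp (h X) = (X + 1) / √(X ^ 2 - 1) := by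
  have hs : 0 < X ^ 2 - 1 := by nlinarith
  have hq : 0 < (X + 1) / (X - 1) := div_pos (by linarith) (by linarith)
  rw [← sq_eq_sq₀ (Real.exp_pos _).le (div_nonneg (by linarith) (Real.sqrt_nonneg _)),
    div_pow, Real.sq_sqrt hs.le, ← Real.exp_nat_mul, h]
  rw [show ((2 : ℕ) : ℝ) * (1 / 2 * Real.log ((X + 1) / (X - 1))) =
    Real.log ((X + 1) / (X - 1)) by push_cast; ring, Real.exp_log hq,
    div_eq_div_iff (by linarith) hs.ne']
  ring

theorem exp_neg_h {X : ℝ} (hX : 1 < X) : Real.exp (-h X) = (X - 1) / √(X ^ 2 - 1) := by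
  have hs : 0 < X ^ 2 - 1 := by nlinarith
  have hs' : 0 < √(X ^ 2 - 1) := Real.sqrt_pos.2 hs
  rw [Real.exp_neg, exp_h hX, inv_div, div_eq_div_iff (by linarith) hs'.ne',
    Real.mul_self_sqrt hs.le]
  ring

theorem cosh_h {X : ℝ} (hX : 1 < X) : Real.cosh (h X) = X / √(X ^ 2 - 1) := by
  rw [Real.cosh_eq, exp_h hX, exp_neg_h hX]
  ring

theorem sinh_h {X : ℝ} (hX : 1 < X) : Real.sinh (h X) = 1 / √(X ^ 2 - 1) := by
  rw [Real.sinh_eq, exp_h hX, exp_neg_h hX]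
  ring

theorem mul_sinh_le_sinh_mul {x b : ℝ} (hx : 1 ≤ x) (hb : 0 ≤ b) :
    x * Real.sinh b ≤ Real.sinh (x * b) := by
  have hd (t : ℝ) : HasDerivAt (fun t ↦ Real.sinh (x * t) - x * Real.sinh t)
      (Real.cosh (x * t) * (x * 1) - x * Real.cosh t) t :=
    ((hasDerivAt_id' t).const_mul x).sinh.sub ((Real.hasDerivAt_sinh t).const_mul x)
  have hm : MonotoneOn (fun t ↦ Real.sinh (x * t) - x * Real.sinh t) (Set.Ici 0) := by
    refine monotoneOn_of_deriv_nonneg (convex_Ici 0)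
      (fun t _ ↦ (hd t).continuousAt.continuousWithinAt)
      (fun t _ ↦ (hd t).differentiableAt.differentiableWithinAt) fun t ht ↦ ?_
    rw [interior_Ici, Set.mem_Ioi] at ht
    have : Real.cosh t ≤ Real.cosh (x * t) := by
      rw [Real.cosh_le_cosh, abs_of_pos ht, abs_of_pos (by positivity)]
      nlinarith
    rw [(hd t).deriv]
    nlinarith
  simpa using hm Set.self_mem_Ici hb hb

theorem arccosh_le_of_le_cosh {u t : ℝ} (hu : 0 < u) (ht : 0 ≤ t) (hut : u ≤ Real.cosh t) :
    arccosh u ≤ t := by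
  have hs : √(u ^ 2 - 1) ≤ Real.sinh t := by
    rw [Real.sqrt_le_left (Real.sinh_nonneg_iff.2 ht), Real.sinh_sq]
    gcongr
  rw [arccosh, Real.log_le_iff_le_exp (add_pos_of_pos_of_nonneg hu (Real.sqrt_nonneg _)),
    ← Real.cosh_add_sinh]
  exact add_le_add hut hs

theorem stmt_1 (x Y Z : ℝ) (hx : 1 < x) (hY : 1 < Y) (hZ : 1 < Z) :
    f x Y Z ≤ h Y + x * h Z := by
  have ha := h_pos hY
  have hb := h_pos hZ
  have hYs : 0 < Y ^ 2 - 1 := by nlinarith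
  have hZs : 0 < Z ^ 2 - 1 := by nlinarith
  have key : (x + Y * Z) / √((Y ^ 2 - 1) * (Z ^ 2 - 1)) =
      Real.cosh (h Y) * Real.cosh (h Z) + Real.sinh (h Y) * (x * Real.sinh (h Z)) := by
    rw [cosh_h hY, cosh_h hZ, sinh_h hY, sinh_h hZ, Real.sqrt_mul hYs.le]
    ring
  refine arccosh_le_of_le_cosh (by positivity) (by positivity) ?_
  rw [key, Real.cosh_add]
  have hc : Real.cosh (h Z) ≤ Real.cosh (x * h Z) := by
    rw [Real.cosh_le_cosh, abs_of_pos hb, abs_of_pos (by positivity)]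
    nlinarith
  exact add_le_add (mul_le_mul_of_nonneg_left hc (Real.cosh_pos _).le)
    (mul_le_mul_of_nonneg_left (mul_sinh_le_sinh_mul hx.le hb.le) (Real.sinh_pos_iff.2 ha).le)
end

section
/- Fix real numbers Y > 1 and Z > 1. Then for every x > 1, the function x ↦ f(x,Y,Z) is twice differentiable at x and its second derivative equals −(x + Y·Z)/(x² + Y² + Z² + 2·x·Y·Z − 1)^{3/2}; in particular, the function x ↦ h(Y) + x·h(Z) − f(x,Y,Z) is strictly convex on (1,∞). -/
theorem hasDerivAt_arccosh_div {c y : ℝ} (hc : 0 < c) (hy : c < y) :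
    HasDerivAt (fun t : ℝ => arccosh (t / c)) (√(y ^ 2 - c ^ 2))⁻¹ y := by
  have hu : y / c ∈ Set.Ioi (1 : ℝ) := (one_lt_div hc).2 hy
  have hsqrt : √((y / c) ^ 2 - 1) = √(y ^ 2 - c ^ 2) / c := by
    rw [show (y / c) ^ 2 - 1 = (y ^ 2 - c ^ 2) / c ^ 2 by field_simp,
      Real.sqrt_div' _ (sq_nonneg c), Real.sqrt_sq hc.le]
  have key := (Real.hasDerivAt_arcosh hu).comp y ((hasDerivAt_id y).div_const c)
  refine key.congr_deriv ?_
  rw [hsqrt]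
  field_simp

theorem sqrt_lt_add_mul {x Y Z : ℝ} (hY : 1 < Y) (hZ : 1 < Z) (hx : 1 < x) :
    √((Y ^ 2 - 1) * (Z ^ 2 - 1)) < x + Y * Z := by
  have hYZ : 0 < Y * Z := by positivity
  rw [Real.sqrt_lt' (by positivity)]
  nlinarith [mul_pos (zero_lt_one.trans hx) hYZ]

theorem discriminant_pos {x Y Z : ℝ} (hY : 1 < Y) (hZ : 1 < Z) (hx : 1 < x) :
    0 < x ^ 2 + Y ^ 2 + Z ^ 2 + 2 * x * Y * Z - 1 := by
  have : 0 < 2 * x * Y * Z := by positivity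
  nlinarith

theorem hasDerivAt_f {x Y Z : ℝ} (hY : 1 < Y) (hZ : 1 < Z) (hx : 1 < x) :
    HasDerivAt (fun t : ℝ => f t Y Z)
      (√(x ^ 2 + Y ^ 2 + Z ^ 2 + 2 * x * Y * Z - 1))⁻¹ x := by
  have hD : 0 < (Y ^ 2 - 1) * (Z ^ 2 - 1) := mul_pos (by nlinarith) (by nlinarith)
  have key := (hasDerivAt_arccosh_div (Real.sqrt_pos.2 hD)
    (sqrt_lt_add_mul hY hZ hx)).comp_add_const x (Y * Z)
  refine key.congr_deriv ?_
  rw [Real.sq_sqrt hD.le]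
  ring_nf

theorem hasDerivAt_deriv_f {x Y Z : ℝ} (hY : 1 < Y) (hZ : 1 < Z) (hx : 1 < x) :
    HasDerivAt (deriv fun t : ℝ => f t Y Z)
      (-(x + Y * Z) / (x ^ 2 + Y ^ 2 + Z ^ 2 + 2 * x * Y * Z - 1) ^ ((3 : ℝ) / 2)) x := by
  have hP := discriminant_pos hY hZ hx
  have hEq : (deriv fun t : ℝ => f t Y Z) =ᶠ[nhds x]
      fun t => (√(t ^ 2 + Y ^ 2 + Z ^ 2 + 2 * t * Y * Z - 1))⁻¹ := by
    filter_upwards [Ioi_mem_nhds hx] with t ht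
    exact (hasDerivAt_f hY hZ ht).deriv
  have hpoly : HasDerivAt (fun t : ℝ => t ^ 2 + Y ^ 2 + Z ^ 2 + 2 * t * Y * Z - 1)
      (2 * (x + Y * Z)) x := by
    have := ((((hasDerivAt_pow 2 x).add_const (Y ^ 2)).add_const (Z ^ 2)).add
      ((((hasDerivAt_id x).const_mul 2).mul_const Y).mul_const Z)).sub_const 1
    refine this.congr_deriv ?_
    norm_num
    ring
  refine HasDerivAt.congr_of_eventuallyEq ?_ hEq
  refine ((hpoly.sqrt hP.ne').fun_inv (Real.sqrt_pos.2 hP).ne').congr_deriv ?_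
  have hpow : (x ^ 2 + Y ^ 2 + Z ^ 2 + 2 * x * Y * Z - 1) ^ ((3 : ℝ) / 2) =
      √(x ^ 2 + Y ^ 2 + Z ^ 2 + 2 * x * Y * Z - 1) ^ 3 := by
    rw [Real.sqrt_eq_rpow, ← Real.rpow_mul_natCast hP.le]
    norm_num
  rw [hpow]
  have hS := Real.sqrt_pos.2 hP
  field_simp

theorem strictConcaveOn_f {Y Z : ℝ} (hY : 1 < Y) (hZ : 1 < Z) :
    StrictConcaveOn ℝ (Set.Ioi (1 : ℝ)) fun x : ℝ => f x Y Z := by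
  refine strictConcaveOn_of_deriv2_neg' (convex_Ioi 1)
    (fun x hx => (hasDerivAt_f hY hZ hx).continuousAt.continuousWithinAt) fun x hx => ?_
  have hx' : 1 < x := hx
  rw [show deriv^[2] (fun x : ℝ => f x Y Z) x = _ from (hasDerivAt_deriv_f hY hZ hx').deriv]
  exact div_neg_of_neg_of_pos (neg_neg_of_pos (by positivity))
    (Real.rpow_pos_of_pos (discriminant_pos hY hZ hx') _)

theorem stmt_4 (Y Z : ℝ) (hY : 1 < Y) (hZ : 1 < Z) :
    (∀ x : ℝ, 1 < x →
      DifferentiableAt ℝ (fun t : ℝ => f t Y Z) x ∧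
      DifferentiableAt ℝ (deriv (fun t : ℝ => f t Y Z)) x ∧
      deriv (deriv (fun t : ℝ => f t Y Z)) x =
        -(x + Y * Z) / (x ^ 2 + Y ^ 2 + Z ^ 2 + 2 * x * Y * Z - 1) ^ ((3 : ℝ) / 2)) ∧
    StrictConvexOn ℝ (Set.Ioi (1 : ℝ)) (fun x : ℝ => h Y + x * h Z - f x Y Z) := by
  refine ⟨fun x hx => ⟨(hasDerivAt_f hY hZ hx).differentiableAt,
    (hasDerivAt_deriv_f hY hZ hx).differentiableAt, (hasDerivAt_deriv_f hY hZ hx).deriv⟩, ?_⟩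
  have hlin : ConvexOn ℝ (Set.Ioi (1 : ℝ)) fun x : ℝ => h Y + x * h Z :=
    (convexOn_const (h Y) (convex_Ioi 1)).add
      ((LinearMap.mulRight ℝ (h Z)).convexOn (convex_Ioi 1))
  exact hlin.sub_strictConcaveOn (strictConcaveOn_f hY hZ)
end

section
/- Let x, y, z, X, Y, Z be real numbers, all > 1. Then the harmonic relation f(x,Y,Z) = f(z,X,Y) + f(y,X,Z) holds if and only if (x + Y·Z)·(X² − 1) − (z + X·Y)·(y + X·Z) = P(X,Y,z)·P(X,y,Z). -/
/-- `P a b c = √(a² + b² + c² + 2abc − 1)`. -/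
noncomputable def P (a b c : ℝ) : ℝ := Real.sqrt (a ^ 2 + b ^ 2 + c ^ 2 + 2 * a * b * c - 1)

theorem arcosh_eq_add_iff {a b c : ℝ} (ha : 1 ≤ a) (hb : 1 ≤ b) (hc : 1 ≤ c) :
    Real.arcosh a = Real.arcosh b + Real.arcosh c ↔
      a = b * c + √(b ^ 2 - 1) * √(c ^ 2 - 1) := by
  have hbc : Real.cosh (Real.arcosh b + Real.arcosh c) =
      b * c + √(b ^ 2 - 1) * √(c ^ 2 - 1) := by
    rw [Real.cosh_add, Real.cosh_arcosh hb, Real.cosh_arcosh hc, Real.sinh_arcosh hb,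
      Real.sinh_arcosh hc]
  rw [← hbc]
  refine ⟨fun h => by rw [← h, Real.cosh_arcosh ha], fun h => ?_⟩
  rw [h, Real.arcosh_cosh (add_nonneg (Real.arcosh_nonneg hb) (Real.arcosh_nonneg hc))]

theorem f_eq_arcosh {x Y Z : ℝ} (hY : 1 < Y) :
    f x Y Z = Real.arcosh ((x + Y * Z) / (√(Y ^ 2 - 1) * √(Z ^ 2 - 1))) := by
  rw [← Real.sqrt_mul (by nlinarith)]
  rfl

theorem sqrt_sq_sub_one_pos {X : ℝ} (hX : 1 < X) : 0 < √(X ^ 2 - 1) :=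
  Real.sqrt_pos.2 (by nlinarith)

theorem one_le_add_mul_div {x Y Z : ℝ} (hx : 1 < x) (hY : 1 < Y) (hZ : 1 < Z) :
    1 ≤ (x + Y * Z) / (√(Y ^ 2 - 1) * √(Z ^ 2 - 1)) := by
  rw [one_le_div (mul_pos (sqrt_sq_sub_one_pos hY) (sqrt_sq_sub_one_pos hZ))]
  have hY' : √(Y ^ 2 - 1) ≤ Y := Real.sqrt_le_iff.2 ⟨by linarith, by linarith⟩
  have hZ' : √(Z ^ 2 - 1) ≤ Z := Real.sqrt_le_iff.2 ⟨by linarith, by linarith⟩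
  have := mul_le_mul hY' hZ' (Real.sqrt_nonneg _) (by linarith)
  linarith

theorem sqrt_add_mul_div_sq_sub_one {x Y Z : ℝ} (hY : 1 < Y) (hZ : 1 < Z) :
    √(((x + Y * Z) / (√(Y ^ 2 - 1) * √(Z ^ 2 - 1))) ^ 2 - 1) =
      P x Y Z / (√(Y ^ 2 - 1) * √(Z ^ 2 - 1)) := by
  have hb := sqrt_sq_sub_one_pos hY
  have hc := sqrt_sq_sub_one_pos hZ
  have hb2 : √(Y ^ 2 - 1) ^ 2 = Y ^ 2 - 1 := Real.sq_sqrt (by nlinarith)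
  have hc2 : √(Z ^ 2 - 1) ^ 2 = Z ^ 2 - 1 := Real.sq_sqrt (by nlinarith)
  have hbc := mul_pos hb hc
  rw [P, ← Real.sqrt_sq hbc.le, ← Real.sqrt_div' _ (sq_nonneg _), Real.sqrt_sq hbc.le,
    div_pow, div_sub_one (pow_pos hbc 2).ne']
  congr 2
  rw [mul_pow, hb2, hc2]
  ring

theorem stmt_5 (x y z X Y Z : ℝ) (hx : 1 < x) (hy : 1 < y) (hz : 1 < z)
    (hX : 1 < X) (hY : 1 < Y) (hZ : 1 < Z) :
    f x Y Z = f z X Y + f y X Z ↔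
      (x + Y * Z) * (X ^ 2 - 1) - (z + X * Y) * (y + X * Z) = P X Y z * P X y Z := by
  have hP₁ : P X Y z = P z X Y := by unfold P; congr 1; ring
  have hP₂ : P X y Z = P y X Z := by unfold P; congr 1; ring
  rw [f_eq_arcosh hY, f_eq_arcosh hX, f_eq_arcosh hX,
    arcosh_eq_add_iff (one_le_add_mul_div hx hY hZ) (one_le_add_mul_div hz hX hY)
      (one_le_add_mul_div hy hX hZ),
    sqrt_add_mul_div_sq_sub_one hX hY, sqrt_add_mul_div_sq_sub_one hX hZ, hP₁, hP₂]
  have hb := sqrt_sq_sub_one_pos hY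
  have hc := sqrt_sq_sub_one_pos hZ
  have ha2 : X ^ 2 - 1 = √(X ^ 2 - 1) ^ 2 := (Real.sq_sqrt (by nlinarith)).symm
  rw [div_mul_div_comm, div_mul_div_comm, ← add_div,
    show √(X ^ 2 - 1) * √(Y ^ 2 - 1) * (√(X ^ 2 - 1) * √(Z ^ 2 - 1)) =
      √(X ^ 2 - 1) ^ 2 * (√(Y ^ 2 - 1) * √(Z ^ 2 - 1)) by ring,
    ← ha2, ← div_div _ (X ^ 2 - 1), div_left_inj' (mul_pos hb hc).ne',
    eq_div_iff (by nlinarith : 0 < X ^ 2 - 1).ne', sub_eq_iff_eq_add']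
end

section
/- (Ptolemy relation of geodesics, algebraic form.) Let x, y, z, X, Y, Z be real numbers, all > 1, satisfying (x + Y·Z)·(X² − 1) − (z + X·Y)·(y + X·Z) = P(X,Y,z)·P(X,y,Z). Then X = ((x·y + z)·Y + (x·z + y)·Z + P(x,y,z)·P(x,Y,Z))/(x² − 1). -/
/-- The determinant of the symmetric `4 × 4` matrix with unit diagonal and off-diagonal entries
`-X, -Z, -Y, -y, -z, -x` (read row by row above the diagonal). -/
def gramDet (x y z X Y Z : ℝ) : ℝ :=
  1 - (x ^ 2 + y ^ 2 + z ^ 2 + X ^ 2 + Y ^ 2 + Z ^ 2)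
    - 2 * (x * y * z + x * Y * Z + X * Y * z + X * y * Z)
    + (x ^ 2 * X ^ 2 + y ^ 2 * Y ^ 2 + z ^ 2 * Z ^ 2)
    - 2 * (x * X * y * Y + x * X * z * Z + y * Y * z * Z)

/-- The off-diagonal cofactor (up to sign) of the matrix of `gramDet` at the entry `-x`. -/
def gramCofactor (x y z X Y Z : ℝ) : ℝ :=
  x * (X ^ 2 - 1) - (y * z + Y * Z) - X * (y * Y + z * Z)

lemma radicand_pos {a b c : ℝ} (ha : 1 < a) (hb : 1 < b) (hc : 1 < c) :
    0 < a ^ 2 + b ^ 2 + c ^ 2 + 2 * a * b * c - 1 := by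
  have : 0 < 2 * a * b * c := by positivity
  nlinarith [sq_nonneg b, sq_nonneg c]

lemma P_pos {a b c : ℝ} (ha : 1 < a) (hb : 1 < b) (hc : 1 < c) : 0 < P a b c :=
  Real.sqrt_pos.2 (radicand_pos ha hb hc)

lemma P_sq {a b c : ℝ} (ha : 1 < a) (hb : 1 < b) (hc : 1 < c) :
    P a b c ^ 2 = a ^ 2 + b ^ 2 + c ^ 2 + 2 * a * b * c - 1 :=
  Real.sq_sqrt (radicand_pos ha hb hc).le

/-- For a singular matrix, opposite off-diagonal cofactors cannot have opposite signs. -/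
lemma gramCofactor_opposite_nonneg {x y z X Y Z : ℝ} (hx : 1 < x) (hy : 1 < y) (hz : 1 < z)
    (hX : 1 < X) (hY : 1 < Y) (hZ : 1 < Z) (hdet : gramDet x y z X Y Z = 0)
    (hpos : 0 < gramCofactor x y z X Y Z) : 0 ≤ gramCofactor X y Z x Y z := by
  by_contra! hneg
  have h₁ := radicand_pos hx hy hz
  have h₂ := radicand_pos hx hY hZ
  have h₃ := radicand_pos hX hY hz
  set a₁₂ := gramCofactor X y Z x Y z with h₁₂
  set a₃₄ := gramCofactor x y z X Y Z with h₃₄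
  obtain ⟨a₁₃, h₁₃⟩ : ∃ a, a = Z * (z ^ 2 - 1) - (X * y + Y * x) - z * (X * x + Y * y) := ⟨_, rfl⟩
  obtain ⟨a₁₄, h₁₄⟩ : ∃ a, a = Y * (y ^ 2 - 1) - (X * z + Z * x) - y * (X * x + Z * z) := ⟨_, rfl⟩
  obtain ⟨a₂₃, h₂₃⟩ : ∃ a, a = y * (Y ^ 2 - 1) - (X * Z + z * x) - Y * (X * x + Z * z) := ⟨_, rfl⟩
  obtain ⟨a₂₄, h₂₄⟩ : ∃ a, a = z * (Z ^ 2 - 1) - (X * Y + y * x) - Z * (X * x + Y * y) := ⟨_, rfl⟩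
  simp only [gramDet, gramCofactor] at hdet h₁₂ h₃₄
  have row₁ : x ^ 2 + y ^ 2 + z ^ 2 + 2 * x * y * z - 1 = X * a₁₂ + Z * a₁₃ + Y * a₁₄ := by
    rw [h₁₂, h₁₃, h₁₄]; linear_combination -hdet
  have row₂ : x ^ 2 + Y ^ 2 + Z ^ 2 + 2 * x * Y * Z - 1 = X * a₁₂ + y * a₂₃ + z * a₂₄ := by
    rw [h₁₂, h₂₃, h₂₄]; linear_combination -hdet
  have m₁ : a₁₃ * a₁₄ = (x ^ 2 + y ^ 2 + z ^ 2 + 2 * x * y * z - 1) * a₃₄ := by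
    rw [h₁₃, h₁₄, h₃₄]; linear_combination -(x + y * z) * hdet
  have m₂ : a₂₃ * a₂₄ = (x ^ 2 + Y ^ 2 + Z ^ 2 + 2 * x * Y * Z - 1) * a₃₄ := by
    rw [h₂₃, h₂₄, h₃₄]; linear_combination -(x + Y * Z) * hdet
  have m₃ : a₁₃ * a₂₃ = (X ^ 2 + Y ^ 2 + z ^ 2 + 2 * X * Y * z - 1) * a₁₂ := by
    rw [h₁₃, h₂₃, h₁₂]; linear_combination -(X + Y * z) * hdet
  have p₁ : 0 < a₁₃ * a₁₄ := m₁ ▸ mul_pos h₁ hpos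
  have p₂ : 0 < a₂₃ * a₂₄ := m₂ ▸ mul_pos h₂ hpos
  have p₃ : a₁₃ * a₂₃ < 0 := m₃ ▸ mul_neg_of_pos_of_neg h₃ hneg
  have q : X * a₁₂ < 0 := mul_neg_of_pos_of_neg (by linarith) hneg
  rcases mul_neg_iff.1 p₃ with ⟨-, h⟩ | ⟨h, -⟩
  · have h' := neg_of_mul_pos_right p₂ h.le
    have : y * a₂₃ < 0 := mul_neg_of_pos_of_neg (by linarith) h
    have : z * a₂₄ < 0 := mul_neg_of_pos_of_neg (by linarith) h'
    linarith
  · have h' := neg_of_mul_pos_right p₁ h.le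
    have : Z * a₁₃ < 0 := mul_neg_of_pos_of_neg (by linarith) h
    have : Y * a₁₄ < 0 := mul_neg_of_pos_of_neg (by linarith) h'
    linarith

theorem stmt_6 (x y z X Y Z : ℝ) (hx : 1 < x) (hy : 1 < y) (hz : 1 < z)
    (hX : 1 < X) (hY : 1 < Y) (hZ : 1 < Z)
    (hrel : (x + Y * Z) * (X ^ 2 - 1) - (z + X * Y) * (y + X * Z) = P X Y z * P X y Z) :
    X = ((x * y + z) * Y + (x * z + y) * Z + P x y z * P x Y Z) / (x ^ 2 - 1) := by
  have s₁ := P_sq hx hy hz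
  have s₂ := P_sq hx hY hZ
  have s₃ := P_sq hX hY hz
  have s₄ := P_sq hX hy hZ
  have hN : gramCofactor x y z X Y Z = P X Y z * P X y Z := by
    rw [← hrel, gramCofactor]; ring
  have hdet : gramDet x y z X Y Z = 0 := by
    have hD : X ^ 2 - 1 ≠ 0 := by nlinarith
    refine (mul_eq_zero.1 ?_).resolve_left hD
    have hsq := congrArg (· ^ 2) hN
    simp only [mul_pow, s₃, s₄, gramCofactor] at hsq
    rw [gramDet]
    linear_combination hsq
  have hM := gramCofactor_opposite_nonneg hx hy hz hX hY hZ hdet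
    (hN ▸ mul_pos (P_pos hX hY hz) (P_pos hX hy hZ))
  have hMP : gramCofactor X y Z x Y z = P x y z * P x Y Z := by
    refine (sq_eq_sq₀ hM (mul_pos (P_pos hx hy hz) (P_pos hx hY hZ)).le).1 ?_
    rw [mul_pow, s₁, s₂]
    simp only [gramDet, gramCofactor] at hdet ⊢
    linear_combination (x ^ 2 - 1) * hdet
  have hd : x ^ 2 - 1 ≠ 0 := by nlinarith
  rw [eq_div_iff hd, ← hMP, gramCofactor]
  ring
end

section
/- (Quadruplet relation.) Let x, y, z, X, Y, Z be real numbers, all > 1, satisfying (x + Y·Z)·(X² − 1) − (z + X·Y)·(y + X·Z) = P(X,Y,z)·P(X,y,Z). Then (x² − 1)·X² + (y² − 1)·Y² + (z² − 1)·Z² − 2·(x·y + z)·X·Y − 2·(y·z + x)·Y·Z − 2·(x·z + y)·X·Z = x² + y² + z² + 2·x·y·z − 1. -/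
theorem stmt_7 (x y z X Y Z : ℝ) (hx : 1 < x) (hy : 1 < y) (hz : 1 < z)
    (hX : 1 < X) (hY : 1 < Y) (hZ : 1 < Z)
    (hrel : (x + Y * Z) * (X ^ 2 - 1) - (z + X * Y) * (y + X * Z) = P X Y z * P X y Z) :
    (x ^ 2 - 1) * X ^ 2 + (y ^ 2 - 1) * Y ^ 2 + (z ^ 2 - 1) * Z ^ 2
      - 2 * (x * y + z) * X * Y - 2 * (y * z + x) * Y * Z - 2 * (x * z + y) * X * Z
      = x ^ 2 + y ^ 2 + z ^ 2 + 2 * x * y * z - 1 := by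
  have radicand_nonneg {a b c : ℝ} (ha : 1 < a) (hb : 1 < b) (hc : 1 < c) :
      0 ≤ a ^ 2 + b ^ 2 + c ^ 2 + 2 * a * b * c - 1 := by
    have : 0 < a * b * c := by positivity
    nlinarith [sq_nonneg b, sq_nonneg c]
  have hsq := congrArg (· ^ 2) hrel
  simp only [P, mul_pow, Real.sq_sqrt (radicand_nonneg hX hY hz),
    Real.sq_sqrt (radicand_nonneg hX hy hZ)] at hsq
  have hX2 : X ^ 2 - 1 ≠ 0 := by nlinarith
  apply mul_left_cancel₀ hX2
  linear_combination hsq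
end

section
/- (Green formula on the tree T₁.) Let (Φ, e) be a harmonic weight map on T₁. Define the level of an edge by: the root edge (0,1) has level 0, and if the Farey pair (r,s) has level n and mediant m, then the Farey pairs (r,m) and (m,s) have level n+1. Then for every natural number n, the sum over all Farey pairs (r,s) of level n of f(e(r,s), Φ(r), Φ(s)) equals f(e(0,1), Φ(0), Φ(1)). -/
/-- `(r, s)` is a Farey pair: `0 ≤ r < s ≤ 1` and, writing `r = p/q`, `s = m/n`
in lowest terms, `q·m − p·n = 1`. -/
def IsFareyPair (r s : ℚ) : Prop :=
  0 ≤ r ∧ r < s ∧ s ≤ 1 ∧ (r.den : ℤ) * s.num - r.num * (s.den : ℤ) = 1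

/-- The mediant `(p+m)/(q+n)` of the Farey pair `(p/q, m/n)`. -/
def mediant (r s : ℚ) : ℚ := ((r.num + s.num : ℤ) : ℚ) / ((r.den + s.den : ℕ) : ℚ)

/-- The edges of the tree `T₁` at combinatorial level `n` from the root:
the root edge `(0,1)` has level `0`, and the two edges `(r, m)`, `(m, s)`
(where `m` is the mediant of `(r,s)`) have level `n+1` when `(r,s)` has level `n`. -/
inductive Level : ℕ → ℚ → ℚ → Prop
  | root : Level 0 0 1
  | left {n : ℕ} {r s : ℚ} : Level n r s → Level (n + 1) r (mediant r s)
  | right {n : ℕ} {r s : ℚ} : Level n r s → Level (n + 1) (mediant r s) s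

theorem IsFareyPair.num_den_mediant {r s : ℚ} (hrs : IsFareyPair r s) :
    (mediant r s).num = r.num + s.num ∧ ((mediant r s).den : ℤ) = r.den + s.den := by
  obtain ⟨-, -, -, hdet⟩ := hrs
  have hpos : (0 : ℤ) < r.den + s.den := by have := r.den_pos; omega
  have hcop : IsCoprime (r.num + s.num) ((r.den : ℤ) + s.den) :=
    ⟨r.den, -r.num, by linear_combination hdet⟩
  have hcop' := Int.isCoprime_iff_nat_coprime.1 hcop
  have heq : mediant r s = ((r.num + s.num : ℤ) : ℚ) / (((r.den : ℤ) + s.den : ℤ) : ℚ) := by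
    simp [mediant]
  rw [heq]
  exact ⟨Rat.num_div_eq_of_coprime hpos hcop', Rat.den_div_eq_of_coprime hpos hcop'⟩

theorem IsFareyPair.left {r s : ℚ} (hrs : IsFareyPair r s) : IsFareyPair r (mediant r s) := by
  obtain ⟨hnum, hden⟩ := hrs.num_den_mediant
  obtain ⟨h0, -, h1, hdet⟩ := hrs
  have hlt : r < mediant r s := by
    rw [Rat.lt_iff, hnum, hden]; linarith
  have hlt' : mediant r s < s := by
    rw [Rat.lt_iff, hnum, hden]; linarith
  refine ⟨h0, hlt, hlt'.le.trans h1, ?_⟩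
  rw [hnum, hden]; linear_combination hdet

theorem IsFareyPair.right {r s : ℚ} (hrs : IsFareyPair r s) : IsFareyPair (mediant r s) s := by
  have hlt := hrs.left.2.1
  obtain ⟨hnum, hden⟩ := hrs.num_den_mediant
  obtain ⟨h0, -, h1, hdet⟩ := hrs
  have hlt' : mediant r s < s := by
    rw [Rat.lt_iff, hnum, hden]; linarith
  refine ⟨h0.trans hlt.le, hlt', h1, ?_⟩
  rw [hnum, hden]; linear_combination hdet

theorem Level.isFareyPair {n : ℕ} {r s : ℚ} (hl : Level n r s) : IsFareyPair r s := by
  induction hl with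
  | root => simp [IsFareyPair]
  | left _ ih => exact ih.left
  | right _ ih => exact ih.right

/-- The finite set of edges of level `n`. -/
noncomputable def levelFinset : ℕ → Finset (ℚ × ℚ)
  | 0 => {(0, 1)}
  | n + 1 => (levelFinset n).image (fun p => (p.1, mediant p.1 p.2)) ∪
      (levelFinset n).image (fun p => (mediant p.1 p.2, p.2))

theorem mem_levelFinset {n : ℕ} {p : ℚ × ℚ} : p ∈ levelFinset n ↔ Level n p.1 p.2 := by
  constructor
  · intro hp
    induction n generalizing p with
    | zero =>
      obtain rfl : p = (0, 1) := by simpa [levelFinset] using hp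
      exact .root
    | succ n ih =>
      rw [levelFinset, Finset.mem_union, Finset.mem_image, Finset.mem_image] at hp
      rcases hp with ⟨q, hq, rfl⟩ | ⟨q, hq, rfl⟩
      · exact .left (ih hq)
      · exact .right (ih hq)
  · obtain ⟨r, s⟩ := p
    intro hl
    change Level n r s at hl
    induction hl with
    | root => simp [levelFinset]
    | left _ ih => exact Finset.mem_union_left _ (Finset.mem_image_of_mem _ ih)
    | right _ ih => exact Finset.mem_union_right _ (Finset.mem_image_of_mem _ ih)

theorem isFareyPair_of_mem_levelFinset {n : ℕ} {p : ℚ × ℚ} (hp : p ∈ levelFinset n) :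
    IsFareyPair p.1 p.2 :=
  (mem_levelFinset.1 hp).isFareyPair

theorem sum_levelFinset_succ (g : ℚ → ℚ → ℝ) (n : ℕ) :
    ∑ p ∈ levelFinset (n + 1), g p.1 p.2 =
      ∑ p ∈ levelFinset n, (g p.1 (mediant p.1 p.2) + g (mediant p.1 p.2) p.2) := by
  rw [levelFinset, Finset.sum_union, Finset.sum_image, Finset.sum_image, Finset.sum_add_distrib]
  · rintro ⟨r, s⟩ hp ⟨r', s'⟩ hq heq
    obtain ⟨hm, rfl⟩ := Prod.mk.inj heq
    obtain ⟨hnum, hden⟩ := (isFareyPair_of_mem_levelFinset hp).num_den_mediant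
    obtain ⟨hnum', hden'⟩ := (isFareyPair_of_mem_levelFinset hq).num_den_mediant
    dsimp only at hm hnum hden hnum' hden'
    rw [hm] at hnum hden
    exact Prod.ext (Rat.ext (by dsimp only; omega) (by dsimp only; omega)) rfl
  · rintro ⟨r, s⟩ hp ⟨r', s'⟩ hq heq
    obtain ⟨rfl, hm⟩ := Prod.mk.inj heq
    obtain ⟨hnum, hden⟩ := (isFareyPair_of_mem_levelFinset hp).num_den_mediant
    obtain ⟨hnum', hden'⟩ := (isFareyPair_of_mem_levelFinset hq).num_den_mediant
    dsimp only at hm hnum hden hnum' hden'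
    rw [hm] at hnum hden
    exact Prod.ext rfl (Rat.ext (by dsimp only; omega) (by dsimp only; omega))
  · rw [Finset.disjoint_left]
    rintro x hx hx'
    obtain ⟨⟨r, s⟩, hp, rfl⟩ := Finset.mem_image.1 hx
    obtain ⟨⟨r', s'⟩, hq, heq⟩ := Finset.mem_image.1 hx'
    obtain ⟨hm, hm'⟩ := Prod.mk.inj heq
    have hden := (isFareyPair_of_mem_levelFinset hp).num_den_mediant.2
    have hden' := (isFareyPair_of_mem_levelFinset hq).num_den_mediant.2
    dsimp only at hm hm' hden hden'
    rw [← hm'] at hden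
    rw [hm] at hden'
    have := s.den_pos
    have := r'.den_pos
    omega

theorem stmt_9 (Φ : ℚ → ℝ) (e : ℚ → ℚ → ℝ)
    (hΦ : ∀ q ∈ Set.Icc (0 : ℚ) 1, 1 < Φ q)
    (he : ∀ r s, IsFareyPair r s → 1 < e r s)
    (hharm : ∀ r s, IsFareyPair r s →
      f (e r s) (Φ r) (Φ s) =
        f (e r (mediant r s)) (Φ r) (Φ (mediant r s)) +
        f (e (mediant r s) s) (Φ (mediant r s)) (Φ s))
    (n : ℕ) :
    ∑' p : {p : ℚ × ℚ // Level n p.1 p.2},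
        f (e p.1.1 p.1.2) (Φ p.1.1) (Φ p.1.2) = f (e 0 1) (Φ 0) (Φ 1) := by
  have htsum : ∀ k, ∑' p : {p : ℚ × ℚ // Level k p.1 p.2},
      f (e p.1.1 p.1.2) (Φ p.1.1) (Φ p.1.2) =
      ∑ p ∈ levelFinset k, f (e p.1 p.2) (Φ p.1) (Φ p.2) := by
    intro k
    have hset : {p : ℚ × ℚ | Level k p.1 p.2} = (levelFinset k : Set (ℚ × ℚ)) := by
      ext p
      exact mem_levelFinset.symm
    rw [← Finset.tsum_subtype' (levelFinset k) (fun p => f (e p.1 p.2) (Φ p.1) (Φ p.2)), ← hset]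
    rfl
  rw [htsum]
  induction n with
  | zero => simp [levelFinset]
  | succ n ih =>
    rw [sum_levelFinset_succ (fun r s => f (e r s) (Φ r) (Φ s)), ← ih]
    exact Finset.sum_congr rfl fun p hp => (hharm p.1 p.2 (isFareyPair_of_mem_levelFinset hp)).symm
end

section
/- Each of the following Diophantine equations has infinitely many solutions in positive integers (X, Y, Z): (i) X² + Y² + Z² − 3XY − 3YZ − 3XZ = 10; (ii) X² + Y² + Z² − 4XY − 4YZ − 4XZ = 9; (iii) X² + 36Y² + 55Z² − 18XY − 90YZ − 20XZ = 360; (iv) X² + 16Y² + 33Z² − 16XY − 48YZ − 18XZ = 144; (v) 4X² + 5Y² + 19Z² − 10XY − 20YZ − 18XZ = 360; (vi) X² + 6Y² + 13Z² − 6XY − 18YZ − 8XZ = 144. -/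
/-- A set `S` is infinite if some nonempty part of it, cut out by a property `P`, is stable under
moves that strictly increase an integer-valued size `m`. -/
theorem Set.infinite_of_forall_exists_size_lt {α : Type*} {S : Set α} (P : α → Prop) (m : α → ℤ)
    (h₀ : ∃ a ∈ S, P a) (h : ∀ a ∈ S, P a → ∃ b ∈ S, P b ∧ m a < m b) : S.Infinite := by
  intro hS
  obtain ⟨a₀, ha₀, hP₀⟩ := h₀
  obtain ⟨a, ⟨haS, haP⟩, hmax⟩ :=
    Set.exists_max_image {a | a ∈ S ∧ P a} m (hS.subset fun _ hx => hx.1) ⟨a₀, ha₀, hP₀⟩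
  obtain ⟨b, hbS, hbP, hlt⟩ := h a haS haP
  exact (hmax b ⟨hbS, hbP⟩).not_gt hlt


theorem stmt_12 :
    {t : ℤ × ℤ × ℤ | 0 < t.1 ∧ 0 < t.2.1 ∧ 0 < t.2.2 ∧
        t.1 ^ 2 + t.2.1 ^ 2 + t.2.2 ^ 2
          - 3 * t.1 * t.2.1 - 3 * t.2.1 * t.2.2 - 3 * t.1 * t.2.2 = 10}.Infinite ∧
    {t : ℤ × ℤ × ℤ | 0 < t.1 ∧ 0 < t.2.1 ∧ 0 < t.2.2 ∧
        t.1 ^ 2 + t.2.1 ^ 2 + t.2.2 ^ 2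
          - 4 * t.1 * t.2.1 - 4 * t.2.1 * t.2.2 - 4 * t.1 * t.2.2 = 9}.Infinite ∧
    {t : ℤ × ℤ × ℤ | 0 < t.1 ∧ 0 < t.2.1 ∧ 0 < t.2.2 ∧
        t.1 ^ 2 + 36 * t.2.1 ^ 2 + 55 * t.2.2 ^ 2
          - 18 * t.1 * t.2.1 - 90 * t.2.1 * t.2.2 - 20 * t.1 * t.2.2 = 360}.Infinite ∧
    {t : ℤ × ℤ × ℤ | 0 < t.1 ∧ 0 < t.2.1 ∧ 0 < t.2.2 ∧
        t.1 ^ 2 + 16 * t.2.1 ^ 2 + 33 * t.2.2 ^ 2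
          - 16 * t.1 * t.2.1 - 48 * t.2.1 * t.2.2 - 18 * t.1 * t.2.2 = 144}.Infinite ∧
    {t : ℤ × ℤ × ℤ | 0 < t.1 ∧ 0 < t.2.1 ∧ 0 < t.2.2 ∧
        4 * t.1 ^ 2 + 5 * t.2.1 ^ 2 + 19 * t.2.2 ^ 2
          - 10 * t.1 * t.2.1 - 20 * t.2.1 * t.2.2 - 18 * t.1 * t.2.2 = 360}.Infinite ∧
    {t : ℤ × ℤ × ℤ | 0 < t.1 ∧ 0 < t.2.1 ∧ 0 < t.2.2 ∧
        t.1 ^ 2 + 6 * t.2.1 ^ 2 + 13 * t.2.2 ^ 2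
          - 6 * t.1 * t.2.1 - 18 * t.2.1 * t.2.2 - 8 * t.1 * t.2.2 = 144}.Infinite := by
  refine ⟨?_, ?_, ?_, ?_, ?_, ?_⟩
  · refine Set.infinite_of_forall_exists_size_lt
      (fun t => t.1 ≤ t.2.1 ∧ t.2.1 ≤ t.2.2) (fun t => t.1 + t.2.1 + t.2.2)
      ⟨(3, 3, 19), by norm_num, by norm_num⟩ ?_
    rintro ⟨x, y, z⟩ ⟨hx, hy, hz, h⟩ ⟨hxy, hyz⟩
    dsimp only at *
    refine ⟨(y, z, 3 * y + 3 * z - x),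
      ⟨by lia, by lia, by lia, ?_⟩, ⟨by lia, by lia⟩, by lia⟩
    linear_combination h
  · refine Set.infinite_of_forall_exists_size_lt
      (fun t => t.1 ≤ t.2.1 ∧ t.2.1 ≤ t.2.2) (fun t => t.1 + t.2.1 + t.2.2)
      ⟨(2, 2, 17), by norm_num, by norm_num⟩ ?_
    rintro ⟨x, y, z⟩ ⟨hx, hy, hz, h⟩ ⟨hxy, hyz⟩
    dsimp only at *
    refine ⟨(y, z, 4 * y + 4 * z - x),
      ⟨by lia, by lia, by lia, ?_⟩, ⟨by lia, by lia⟩, by lia⟩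
    linear_combination h
  · refine Set.infinite_of_forall_exists_size_lt
      (fun t => t.1 ≤ 9 * t.2.1 ∧ 2 ∣ t.1 + 5 * t.2.2) (fun t => t.1)
      ⟨(3, 17, 21), by norm_num, by norm_num⟩ ?_
    rintro ⟨x, y, z⟩ ⟨hx, hy, hz, h⟩ ⟨hxy, k, hk⟩
    dsimp only at *
    obtain rfl : x = 2 * k - 5 * z := by linarith
    refine ⟨(18 * y + 25 * z - 2 * k, 8 * y + 15 * z - k, z),
      ⟨by lia, by lia, by lia, ?_⟩, ⟨by lia, by lia⟩, by lia⟩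
    linear_combination h
  · refine Set.infinite_of_forall_exists_size_lt
      (fun t => t.1 ≤ 8 * t.2.1) (fun t => t.1)
      ⟨(3, 12, 3), by norm_num, by norm_num⟩ ?_
    rintro ⟨x, y, z⟩ ⟨hx, hy, hz, h⟩ hxy
    dsimp only at *
    refine ⟨(16 * y + 18 * z - x, 15 * y + 21 * z - x, z),
      ⟨by lia, by lia, by lia, ?_⟩, by lia, by lia⟩
    linear_combination h
  · refine Set.infinite_of_forall_exists_size_lt
      (fun t => 4 * t.1 ≤ 5 * t.2.1 ∧ 2 ∣ 5 * t.2.1 + 9 * t.2.2) (fun t => t.1)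
      ⟨(3, 21, 3), by norm_num, by norm_num⟩ ?_
    rintro ⟨x, y, z⟩ ⟨hx, hy, hz, h⟩ ⟨hxy, hyz⟩
    dsimp only at *
    obtain ⟨j, rfl⟩ : ∃ j, y = z + 2 * j := ⟨(y - z) / 2, by omega⟩
    refine ⟨(7 * z + 5 * j - x, 17 * z + 8 * j - 2 * x, z),
      ⟨by lia, by lia, by lia, ?_⟩, ⟨by lia, by lia⟩, by lia⟩
    linear_combination h
  · refine Set.infinite_of_forall_exists_size_lt
      (fun t => t.1 ≤ 3 * t.2.1) (fun t => t.1)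
      ⟨(2, 10, 2), by norm_num, by norm_num⟩ ?_
    rintro ⟨x, y, z⟩ ⟨hx, hy, hz, h⟩ hxy
    dsimp only at *
    refine ⟨(6 * y + 8 * z - x, 5 * y + 11 * z - x, z),
      ⟨by lia, by lia, by lia, ?_⟩, by lia, by lia⟩
    linear_combination h
end

section
/- Let a, b, c be real numbers and let B(x,y) := a·x² + b·x·y + c·y². Let u = (x₁,y₁) and v = (x₂,y₂) be vectors such that |x₁·y₂ − x₂·y₁| = 1, and set X := B(u+v), Y := B(u), Z := B(v). Then X² + Y² + Z² − 2XY − 2YZ − 2XZ = b² − 4·a·c. -/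
/-- The binary quadratic form `B(x,y) = a·x² + b·x·y + c·y²` evaluated on a vector. -/
def B (a b c : ℝ) (w : ℝ × ℝ) : ℝ := a * w.1 ^ 2 + b * w.1 * w.2 + c * w.2 ^ 2

theorem stmt_14 (a b c : ℝ) (u v : ℝ × ℝ) (huv : |u.1 * v.2 - v.1 * u.2| = 1)
    (X Y Z : ℝ) (hX : X = B a b c (u + v)) (hY : Y = B a b c u) (hZ : Z = B a b c v) :
    X ^ 2 + Y ^ 2 + Z ^ 2 - 2 * X * Y - 2 * Y * Z - 2 * X * Z = b ^ 2 - 4 * a * c := by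
  have hdet : (u.1 * v.2 - v.1 * u.2) ^ 2 = 1 := by rw [← sq_abs, huv, one_pow]
  subst hX hY hZ
  simp only [B, Prod.fst_add, Prod.snd_add]
  linear_combination (b ^ 2 - 4 * a * c) * hdet
end

section
/- (Golden-ratio identity from Basmajian's identity on the pair of pants with orthobasis a = b = c = 3.) Let Φ : ℚ ∩ [0,1] → ℝ be the function determined by Φ(0) = Φ(1) = 3 and, for every Farey pair (r,s) with mediant m, Φ(m) = (3·Φ(r) + 3·Φ(s) + √(5·(Φ(r)² + Φ(s)² + 6·Φ(r)·Φ(s) + 8)))/2. Then the family ( log((Φ(q)+1)/(Φ(q)−1)) )_{q ∈ ℚ ∩ [0,1]} is summable and the infinite product ∏_{q ∈ ℚ ∩ [0,1]} (Φ(q)+1)/(Φ(q)−1) equals 2·φ² = 3 + √5, where φ = (1+√5)/2 is the golden ratio. -/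
namespace IsFareyPair

variable {r s : ℚ}

lemma coprime_mediant (h : IsFareyPair r s) :
    Nat.Coprime (r.num + s.num).natAbs ((r.den + s.den : ℕ) : ℤ).natAbs := by
  rw [← Int.isCoprime_iff_nat_coprime]
  refine ⟨r.den, -r.num, ?_⟩
  have := h.2.2.2
  push_cast
  linear_combination this

lemma num_mediant (h : IsFareyPair r s) : (mediant r s).num = r.num + s.num := by
  have h2 := Rat.num_div_eq_of_coprime (a := r.num + s.num) (b := ((r.den + s.den : ℕ) : ℤ))
    (by have := r.den_pos; omega) h.coprime_mediant
  rw [← h2, mediant, Int.cast_natCast]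

lemma den_mediant (h : IsFareyPair r s) : (mediant r s).den = r.den + s.den := by
  have h2 := Rat.den_div_eq_of_coprime (a := r.num + s.num) (b := ((r.den + s.den : ℕ) : ℤ))
    (by have := r.den_pos; omega) h.coprime_mediant
  rw [Int.cast_natCast] at h2
  exact Int.ofNat_inj.1 h2

lemma left_lt_mediant (h : IsFareyPair r s) : r < mediant r s := by
  rw [Rat.lt_iff, h.num_mediant, h.den_mediant]
  have := h.2.2.2
  push_cast
  linarith

lemma mediant_lt_right (h : IsFareyPair r s) : mediant r s < s := by
  rw [Rat.lt_iff, h.num_mediant, h.den_mediant]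
  have := h.2.2.2
  push_cast
  linarith

lemma left_s15 (h : IsFareyPair r s) : IsFareyPair r (mediant r s) := by
  refine ⟨h.1, h.left_lt_mediant, h.mediant_lt_right.le.trans h.2.2.1, ?_⟩
  rw [h.num_mediant, h.den_mediant]
  have := h.2.2.2
  push_cast
  linarith

lemma right_s15 (h : IsFareyPair r s) : IsFareyPair (mediant r s) s := by
  refine ⟨h.1.trans h.left_lt_mediant.le, h.mediant_lt_right, h.2.2.1, ?_⟩
  rw [h.num_mediant, h.den_mediant]
  have := h.2.2.2
  push_cast
  linarith

/-- A rational strictly between the members of a Farey pair has at least the denominator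
of the mediant. -/
lemma den_add_den_le (h : IsFareyPair r s) {q : ℚ} (hr : r < q) (hs : q < s) :
    r.den + s.den ≤ q.den := by
  rw [Rat.lt_iff] at hr hs
  have h1 : (1 : ℤ) ≤ q.num * r.den - r.num * q.den := by linarith
  have h2 : (1 : ℤ) ≤ s.num * q.den - q.num * s.den := by linarith
  have hd : (q.den : ℤ) = s.den * (q.num * r.den - r.num * q.den) +
      r.den * (s.num * q.den - q.num * s.den) := by
    linear_combination -(q.den : ℤ) * h.2.2.2
  have h3 := mul_le_mul_of_nonneg_left h1 (Int.natCast_nonneg s.den)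
  have h4 := mul_le_mul_of_nonneg_left h2 (Int.natCast_nonneg r.den)
  zify
  linarith

end IsFareyPair

lemma isFareyPair_zero_one : IsFareyPair 0 1 := by
  refine ⟨le_rfl, zero_lt_one, le_rfl, by norm_num⟩

/-- The mediants obtained from `(r, s)` in at most `n` subdivision steps. -/
def fareyTree : ℕ → ℚ → ℚ → Finset ℚ
  | 0, _, _ => ∅
  | n + 1, r, s =>
      insert (mediant r s) (fareyTree n r (mediant r s) ∪ fareyTree n (mediant r s) s)

lemma mem_Ioo_of_mem_fareyTree {n : ℕ} {r s q : ℚ} (h : IsFareyPair r s)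
    (hq : q ∈ fareyTree n r s) : q ∈ Set.Ioo r s := by
  induction n generalizing r s with
  | zero => simp [fareyTree] at hq
  | succ n ih =>
    simp only [fareyTree, Finset.mem_insert, Finset.mem_union] at hq
    rcases hq with rfl | hq | hq
    · exact ⟨h.left_lt_mediant, h.mediant_lt_right⟩
    · exact ⟨(ih h.left_s15 hq).1, (ih h.left_s15 hq).2.trans h.mediant_lt_right⟩
    · exact ⟨h.left_lt_mediant.trans (ih h.right_s15 hq).1, (ih h.right_s15 hq).2⟩

lemma mem_fareyTree_of_den_lt {n : ℕ} {r s q : ℚ} (h : IsFareyPair r s) (hq : q ∈ Set.Ioo r s)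
    (hn : q.den < r.den + s.den + n) : q ∈ fareyTree n r s := by
  induction n generalizing r s with
  | zero =>
    have := h.den_add_den_le hq.1 hq.2
    omega
  | succ n ih =>
    have hr := r.den_pos
    have hs := s.den_pos
    simp only [fareyTree, Finset.mem_insert, Finset.mem_union]
    rcases lt_trichotomy q (mediant r s) with hlt | heq | hgt
    · exact Or.inr (Or.inl (ih h.left_s15 ⟨hq.1, hlt⟩ (by rw [h.den_mediant]; omega)))
    · exact Or.inl heq
    · exact Or.inr (Or.inr (ih h.right_s15 ⟨hgt, hq.2⟩ (by rw [h.den_mediant]; omega)))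

lemma monotone_fareyTree (r s : ℚ) : Monotone fun n => fareyTree n r s := by
  refine monotone_nat_of_le_succ fun n => ?_
  induction n generalizing r s with
  | zero => simp [fareyTree]
  | succ n ih =>
    rw [fareyTree, fareyTree]
    exact Finset.insert_subset_insert _ (Finset.union_subset_union (ih _ _) (ih _ _))

lemma sum_fareyTree_succ {r s : ℚ} (h : IsFareyPair r s) (n : ℕ) (f : ℚ → ℝ) :
    ∑ q ∈ fareyTree (n + 1) r s, f q = f (mediant r s) +
      (∑ q ∈ fareyTree n r (mediant r s), f q + ∑ q ∈ fareyTree n (mediant r s) s, f q) := by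
  rw [fareyTree, Finset.sum_insert, Finset.sum_union]
  · rw [Finset.disjoint_left]
    intro q h1 h2
    exact lt_asymm (mem_Ioo_of_mem_fareyTree h.left_s15 h1).2 (mem_Ioo_of_mem_fareyTree h.right_s15 h2).1
  · rw [Finset.mem_union]
    rintro (h1 | h1)
    · exact lt_irrefl _ (mem_Ioo_of_mem_fareyTree h.left_s15 h1).2
    · exact lt_irrefl _ (mem_Ioo_of_mem_fareyTree h.right_s15 h1).1

/-- The square root of minus the Gram determinant of a right-angled hexagon with alternating
sides of hyperbolic cosine `x`, `y` and `3`. -/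
noncomputable def hexagonRoot (x y : ℝ) : ℝ := √(x ^ 2 + y ^ 2 + 6 * x * y + 8)

/-- The value at the mediant of a Farey pair with values `x` and `y`. -/
noncomputable def mediantValue (x y : ℝ) : ℝ := (3 * x + 3 * y + √5 * hexagonRoot x y) / 2

/-- The exponential of the length of the gap between the shadows of two neighbouring
orthogeodesics whose lengths have hyperbolic cosine `x` and `y`. -/
noncomputable def gapExp (x y : ℝ) : ℝ := (x * y + 3 + hexagonRoot x y) / ((x + 1) * (y + 1))

/-- The length of the shadow of an orthogeodesic whose length has hyperbolic cosine `x`. -/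
noncomputable def shadow (x : ℝ) : ℝ := Real.log ((x + 1) / (x - 1))

section Gap

variable {x y : ℝ}

lemma hexagonRoot_nonneg (x y : ℝ) : 0 ≤ hexagonRoot x y := Real.sqrt_nonneg _

lemma hexagonRoot_sq (hx : 0 ≤ x) (hy : 0 ≤ y) :
    hexagonRoot x y ^ 2 = x ^ 2 + y ^ 2 + 6 * x * y + 8 :=
  Real.sq_sqrt (by positivity)

lemma hexagonRoot_comm (x y : ℝ) : hexagonRoot x y = hexagonRoot y x := by
  unfold hexagonRoot
  ring_nf

lemma mediantValue_comm (x y : ℝ) : mediantValue x y = mediantValue y x := by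
  rw [mediantValue, mediantValue, hexagonRoot_comm]
  ring

lemma three_le_mediantValue (hx : 3 ≤ x) (hy : 3 ≤ y) : 3 ≤ mediantValue x y := by
  have := mul_nonneg (Real.sqrt_nonneg 5) (hexagonRoot_nonneg x y)
  unfold mediantValue
  linarith

lemma hexagonRoot_mediantValue (hx : 0 ≤ x) (hy : 0 ≤ y) :
    hexagonRoot x (mediantValue x y) =
      (3 * √5 * x + √5 * y + 3 * hexagonRoot x y) / 2 := by
  have hS := hexagonRoot_nonneg x y
  rw [hexagonRoot, Real.sqrt_eq_iff_eq_sq (by unfold mediantValue; positivity) (by positivity)]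
  have h5 : √5 ^ 2 = (5 : ℝ) := Real.sq_sqrt (by norm_num)
  have hS2 := hexagonRoot_sq hx hy
  unfold mediantValue
  generalize hexagonRoot x y = S at *
  generalize √5 = t at *
  linear_combination (S ^ 2 / 4 - (3 * x + y) ^ 2 / 4) * h5 + (5 / 4 - 9 / 4) * hS2

lemma gapExp_eq_mul (hx : 3 ≤ x) (hy : 3 ≤ y) :
    gapExp x y = (mediantValue x y + 1) / (mediantValue x y - 1) *
      (gapExp x (mediantValue x y) * gapExp (mediantValue x y) y) := by
  have hm := three_le_mediantValue hx hy
  have hS2 := hexagonRoot_sq (x := x) (y := y) (by linarith) (by linarith)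
  have h1 := hexagonRoot_mediantValue (x := x) (y := y) (by linarith) (by linarith)
  have h2 := hexagonRoot_mediantValue (x := y) (y := x) (by linarith) (by linarith)
  rw [mediantValue_comm, hexagonRoot_comm, hexagonRoot_comm y x] at h2
  have key : (x * y + 3 + hexagonRoot x y) * (mediantValue x y ^ 2 - 1) =
      (x * mediantValue x y + 3 + hexagonRoot x (mediantValue x y)) *
        (mediantValue x y * y + 3 + hexagonRoot (mediantValue x y) y) := by
    rw [h1, h2]
    have h5 : √5 ^ 2 = (5 : ℝ) := Real.sq_sqrt (by norm_num)
    unfold mediantValue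
    generalize hexagonRoot x y = S at *
    generalize √5 = t at *
    grind
  unfold gapExp
  have hx1 : x + 1 ≠ 0 := by linarith
  have hy1 : y + 1 ≠ 0 := by linarith
  have hm1 : mediantValue x y + 1 ≠ 0 := by linarith
  have hm2 : mediantValue x y - 1 ≠ 0 := by linarith
  rw [div_mul_div_comm, div_mul_div_comm, div_eq_div_iff (by positivity) (by positivity)]
  linear_combination (x + 1) * (y + 1) * (mediantValue x y + 1) * key

lemma one_le_gapExp (hx : 3 ≤ x) (hy : 3 ≤ y) : 1 ≤ gapExp x y := by
  have hS : x + y ≤ hexagonRoot x y := Real.le_sqrt_of_sq_le (by nlinarith)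
  rw [gapExp, one_le_div (by positivity)]
  nlinarith

lemma log_gapExp_eq_add (hx : 3 ≤ x) (hy : 3 ≤ y) :
    Real.log (gapExp x y) = shadow (mediantValue x y) +
      (Real.log (gapExp x (mediantValue x y)) + Real.log (gapExp (mediantValue x y) y)) := by
  have hm := three_le_mediantValue hx hy
  have h1 := one_le_gapExp hx hm
  have h2 := one_le_gapExp hm hy
  have h3 : mediantValue x y + 1 ≠ 0 := by linarith
  have h4 : mediantValue x y - 1 ≠ 0 := by linarith
  rw [gapExp_eq_mul hx hy, Real.log_mul (div_ne_zero h3 h4) (by positivity),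
    Real.log_mul (by positivity) (by positivity), shadow]

lemma shadow_nonneg (hx : 1 < x) : 0 ≤ shadow x :=
  Real.log_nonneg ((one_le_div (by linarith)).2 (by linarith))

lemma two_div_le_shadow (hx : 1 < x) : 2 / (x + 1) ≤ shadow x := by
  have h1 : 0 < x - 1 := by linarith
  have h2 : 0 < x + 1 := by linarith
  have h := Real.one_sub_inv_le_log_of_pos (div_pos h2 h1)
  refine le_trans (le_of_eq ?_) h
  rw [inv_div]
  field_simp
  ring

/-- The shadow at the mediant covers a definite proportion of the gap. -/
lemma log_gapExp_le (hx : 3 ≤ x) (hy : 3 ≤ y) :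
    Real.log (gapExp x y) ≤ 8 * shadow (mediantValue x y) := by
  have hm := three_le_mediantValue hx hy
  have hS2 := hexagonRoot_sq (x := x) (y := y) (by linarith) (by linarith)
  have hS : x + y ≤ hexagonRoot x y := Real.le_sqrt_of_sq_le (by nlinarith)
  have hgap : gapExp x y ≤ 1 + 4 / (x + y) := by
    rw [gapExp, div_le_iff₀ (by positivity)]
    have hS' : hexagonRoot x y ≤ x + y + (2 * x * y + 4) / (x + y) := by
      rw [← sub_le_iff_le_add', le_div_iff₀ (by positivity)]
      nlinarith
    refine (add_le_add_right hS' _).trans ?_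
    rw [← sub_nonneg]
    have : (1 + 4 / (x + y)) * ((x + 1) * (y + 1)) -
        (x * y + 3 + (x + y + (2 * x * y + 4) / (x + y))) = 2 * (x * y + x + y) / (x + y) := by
      field_simp
      ring
    rw [this]
    positivity
  have hmle : mediantValue x y + 1 ≤ 4 * (x + y) := by
    have h : √5 * hexagonRoot x y ≤ 4 * (x + y) := by
      rw [hexagonRoot, ← Real.sqrt_mul (by norm_num)]
      exact Real.sqrt_le_iff.2 ⟨by positivity, by nlinarith [sq_nonneg (x - y)]⟩
    unfold mediantValue
    linarith
  calc Real.log (gapExp x y) ≤ gapExp x y - 1 :=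
        Real.log_le_sub_one_of_pos (by linarith [one_le_gapExp hx hy])
    _ ≤ 4 / (x + y) := by linarith
    _ = 8 * (2 / (4 * (x + y))) := by field_simp; norm_num
    _ ≤ 8 * (2 / (mediantValue x y + 1)) := by gcongr
    _ ≤ 8 * shadow (mediantValue x y) := by
        gcongr
        exact two_div_le_shadow (by linarith)

end Gap

section Tree

variable {Φ : ℚ → ℝ}

lemma three_le_of_mem_fareyTree
    (hrec : ∀ r s : ℚ, IsFareyPair r s → Φ (mediant r s) = mediantValue (Φ r) (Φ s))
    {n : ℕ} {r s q : ℚ} (h : IsFareyPair r s) (hr : 3 ≤ Φ r)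
    (hs : 3 ≤ Φ s) (hq : q ∈ fareyTree n r s) : 3 ≤ Φ q := by
  induction n generalizing r s with
  | zero => simp [fareyTree] at hq
  | succ n ih =>
    have hm : 3 ≤ Φ (mediant r s) := by
      rw [hrec r s h]
      exact three_le_mediantValue hr hs
    simp only [fareyTree, Finset.mem_insert, Finset.mem_union] at hq
    rcases hq with rfl | hq | hq
    · exact hm
    · exact ih h.left_s15 hr hm hq
    · exact ih h.right_s15 hm hs hq

lemma log_gapExp_sub_sum_mem_Icc
    (hrec : ∀ r s : ℚ, IsFareyPair r s → Φ (mediant r s) = mediantValue (Φ r) (Φ s))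
    (n : ℕ) {r s : ℚ} (h : IsFareyPair r s) (hr : 3 ≤ Φ r)
    (hs : 3 ≤ Φ s) :
    Real.log (gapExp (Φ r) (Φ s)) - ∑ q ∈ fareyTree n r s, shadow (Φ q) ∈
      Set.Icc 0 ((7 / 8) ^ n * Real.log (gapExp (Φ r) (Φ s))) := by
  induction n generalizing r s with
  | zero => simpa [fareyTree] using Real.log_nonneg (one_le_gapExp hr hs)
  | succ n ih =>
    have hm : 3 ≤ Φ (mediant r s) := by
      rw [hrec r s h]
      exact three_le_mediantValue hr hs
    obtain ⟨h1, h1'⟩ := ih h.left_s15 hr hm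
    obtain ⟨h2, h2'⟩ := ih h.right_s15 hm hs
    have hadd := log_gapExp_eq_add hr hs
    have hle := log_gapExp_le hr hs
    rw [← hrec r s h] at hadd hle
    rw [sum_fareyTree_succ h]
    refine ⟨by linarith, ?_⟩
    have hpow : (0 : ℝ) ≤ (7 / 8) ^ n := by positivity
    have := mul_le_mul_of_nonneg_left (show Real.log (gapExp (Φ r) (Φ (mediant r s))) +
      Real.log (gapExp (Φ (mediant r s)) (Φ s)) ≤
        7 / 8 * Real.log (gapExp (Φ r) (Φ s)) by linarith) hpow
    rw [pow_succ]
    linarith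

/-- The shadows of the rationals strictly between a Farey pair fill the gap of the pair. -/
lemma hasSum_shadow_Ioo
    (hrec : ∀ r s : ℚ, IsFareyPair r s → Φ (mediant r s) = mediantValue (Φ r) (Φ s))
    {r s : ℚ} (h : IsFareyPair r s) (hr : 3 ≤ Φ r) (hs : 3 ≤ Φ s) :
    HasSum ((Set.Ioo r s).indicator fun q => shadow (Φ q))
      (Real.log (gapExp (Φ r) (Φ s))) := by
  have hmem : ∀ q ∈ Set.Ioo r s, ∃ n, q ∈ fareyTree n r s := fun q hq =>
    ⟨q.den, mem_fareyTree_of_den_lt h hq (by have := r.den_pos; omega)⟩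
  have hnonneg : ∀ q, 0 ≤ (Set.Ioo r s).indicator (fun q => shadow (Φ q)) q := by
    refine Set.indicator_nonneg fun q hq => ?_
    obtain ⟨n, hn⟩ := hmem q hq
    exact shadow_nonneg (by linarith [three_le_of_mem_fareyTree hrec h hr hs hn])
  have hsum : ∀ n, ∑ q ∈ fareyTree n r s, (Set.Ioo r s).indicator (fun q => shadow (Φ q)) q =
      ∑ q ∈ fareyTree n r s, shadow (Φ q) := fun n =>
    Finset.sum_congr rfl fun q hq => Set.indicator_of_mem (mem_Ioo_of_mem_fareyTree h hq) _
  refine hasSum_of_isLUB_of_nonneg _ hnonneg ⟨?_, fun b hb => ?_⟩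
  · rintro _ ⟨u, rfl⟩
    let N := u.sup Rat.den
    refine le_trans ?_ (sub_nonneg.1 (log_gapExp_sub_sum_mem_Icc hrec N h hr hs).1)
    rw [← hsum]
    have hsub : ∀ q ∈ u, q ∉ fareyTree N r s →
        (Set.Ioo r s).indicator (fun q => shadow (Φ q)) q = 0 := by
      intro q hq hqN
      refine Set.indicator_of_notMem (fun hmem => hqN (mem_fareyTree_of_den_lt h hmem ?_)) _
      have := r.den_pos
      have : q.den ≤ N := Finset.le_sup (f := Rat.den) hq
      omega
    beta_reduce
    rw [← Finset.sum_subset (Finset.inter_subset_left (s₁ := u) (s₂ := fareyTree N r s))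
      fun q hq hq' => hsub q hq fun hN => hq' (Finset.mem_inter.2 ⟨hq, hN⟩)]
    exact Finset.sum_le_sum_of_subset_of_nonneg Finset.inter_subset_right fun q _ _ => hnonneg q
  · have hlim : Filter.Tendsto (fun n : ℕ => b + (7 / 8 : ℝ) ^ n *
        Real.log (gapExp (Φ r) (Φ s))) Filter.atTop (nhds (b + 0 * _)) :=
      ((tendsto_pow_atTop_nhds_zero_of_lt_one (by norm_num) (by norm_num)).mul_const _).const_add b
    rw [zero_mul, add_zero] at hlim
    refine ge_of_tendsto' hlim fun n => ?_
    have h1 := (log_gapExp_sub_sum_mem_Icc hrec n h hr hs).2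
    have h2 := hb ⟨fareyTree n r s, rfl⟩
    simp only [hsum] at h2
    linarith

end Tree

lemma gapExp_three_three : gapExp 3 3 = (3 + √5) / 4 := by
  have h : hexagonRoot 3 3 = 4 * √5 := by
    rw [hexagonRoot, show (3 : ℝ) ^ 2 + 3 ^ 2 + 6 * 3 * 3 + 8 = 4 ^ 2 * 5 by norm_num,
      Real.sqrt_mul (by norm_num), Real.sqrt_sq (by norm_num)]
  rw [gapExp, h]
  ring

theorem stmt_15 (Φ : ℚ → ℝ) (h0 : Φ 0 = 3) (h1 : Φ 1 = 3)
    (hrec : ∀ r s : ℚ, IsFareyPair r s →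
      Φ (mediant r s) =
        (3 * Φ r + 3 * Φ s +
          Real.sqrt (5 * (Φ r ^ 2 + Φ s ^ 2 + 6 * Φ r * Φ s + 8))) / 2) :
    Summable (fun q : {q : ℚ // q ∈ Set.Icc (0 : ℚ) 1} =>
        Real.log ((Φ q + 1) / (Φ q - 1))) ∧
      Real.exp (∑' q : {q : ℚ // q ∈ Set.Icc (0 : ℚ) 1},
          Real.log ((Φ q + 1) / (Φ q - 1))) = 3 + Real.sqrt 5 := by
  have hrec' : ∀ r s : ℚ, IsFareyPair r s → Φ (mediant r s) = mediantValue (Φ r) (Φ s) := by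
    intro r s h
    rw [hrec r s h, Real.sqrt_mul (by norm_num), mediantValue, hexagonRoot]
  have hinner := hasSum_shadow_Ioo hrec' isFareyPair_zero_one h0.ge h1.ge
  rw [h0, h1, gapExp_three_three] at hinner
  have hshadow : shadow 3 = Real.log 2 := by norm_num [shadow]
  have hends := hasSum_sum_of_ne_finset_zero (s := ({0, 1} : Finset ℚ))
    (f := ({0, 1} : Set ℚ).indicator fun q => shadow (Φ q)) (L := .unconditional ℚ)
    (fun q hq => Set.indicator_of_notMem (by simpa using hq) _)
  rw [Finset.sum_pair zero_ne_one, Set.indicator_of_mem (by simp), Set.indicator_of_mem (by simp),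
    h0, h1, hshadow] at hends
  have htotal := hends.add hinner
  have hIcc : Set.Icc (0 : ℚ) 1 = {0, 1} ∪ Set.Ioo 0 1 := by
    rw [Set.union_comm, Set.Ioo_union_both zero_le_one]
  have hdisj : Disjoint ({0, 1} : Set ℚ) (Set.Ioo 0 1) := by
    simp [Set.disjoint_insert_left]
  have hsum : HasSum (fun q : {q : ℚ // q ∈ Set.Icc (0 : ℚ) 1} =>
      Real.log ((Φ q + 1) / (Φ q - 1)))
      (Real.log 2 + Real.log 2 + Real.log ((3 + √5) / 4)) := by
    refine (hasSum_subtype_iff_indicator (f := fun q => shadow (Φ q))).2 ?_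
    rw [hIcc, Set.indicator_union_of_disjoint hdisj]
    exact htotal
  refine ⟨hsum.summable, ?_⟩
  rw [hsum.tsum_eq, Real.exp_add, Real.exp_add, Real.exp_log two_pos, Real.exp_log (by positivity)]
  ring
end
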